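/- Let G = A × B be the direct product of groups A and B, and let φ be an injective endomorphism of G with Aφ ⊆ A and Bφ ⊆ B. Let b ∈ B and let D be the subgroup of the descending HNN-extension G(φ) generated by A and the element tb. Then D contains the subgroup U = ⋃_{k≥0} tᵏAt⁻ᵏ. -/

import Mathlib

/-- A group has the Howson property if the intersection of any two finitely
generated subgroups is finitely generated. -/
def HowsonGroup (G : Type*) [Group G] : Prop :=
  ∀ H K : Subgroup G, H.FG → K.FG → (H ⊓ K).FG

/-- The descending HNN-extension `G(φ) = ⟨G, t ; t⁻¹ g t = gφ (g ∈ G)⟩` of a group `G`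
with respect to an injective endomorphism `φ`, realized as the Mathlib `HNNExtension`
with base `G`, associated subgroups `φ.range` and `G` (i.e. `⊤`), so that the relation
`t⁻¹ * of g * t = of (φ g)` holds for all `g : G`. -/
abbrev DescHNN {G : Type*} [Group G] (φ : G →* G) (hφ : Function.Injective φ) : Type _ :=
  HNNExtension G (MonoidHom.range φ) ⊤
    ((MonoidHom.ofInjective hφ).symm.trans Subgroup.topEquiv.symm)

namespace DescHNN

theorem of_mul_t {G : Type*} [Group G] (φ : G →* G) (hφ : Function.Injective φ) (g : G) :
    (HNNExtension.of g * HNNExtension.t : DescHNN φ hφ) =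
      HNNExtension.t * HNNExtension.of (φ g) := by
  have h := HNNExtension.t_mul_of (φ := (MonoidHom.ofInjective hφ).symm.trans
    Subgroup.topEquiv.symm) (MonoidHom.ofInjective hφ g)
  simpa [MonoidHom.ofInjective_apply] using h.symm

theorem of_mul_t_pow {G : Type*} [Group G] (φ : G →* G) (hφ : Function.Injective φ) (g : G)
    (k : ℕ) :
    (HNNExtension.of g * HNNExtension.t ^ k : DescHNN φ hφ) =
      HNNExtension.t ^ k * HNNExtension.of (φ^[k] g) := by
  induction k with
  | zero => simp
  | succ k ih =>
    rw [pow_succ, ← mul_assoc, ih, mul_assoc, of_mul_t, Function.iterate_succ_apply', mul_assoc]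

/-- If `φ^[k] g` commutes with `x`, then `g` commutes with `tᵏ x t⁻ᵏ`. -/
theorem commute_of_conj_t_pow {G : Type*} [Group G] (φ : G →* G) (hφ : Function.Injective φ)
    {g x : G} {k : ℕ} (h : Commute (φ^[k] g) x) :
    Commute (HNNExtension.of g : DescHNN φ hφ)
      (HNNExtension.t ^ k * HNNExtension.of x * (HNNExtension.t ^ k)⁻¹) := by
  have hg : (HNNExtension.of g : DescHNN φ hφ) =
      HNNExtension.t ^ k * HNNExtension.of (φ^[k] g) * (HNNExtension.t ^ k)⁻¹ :=
    eq_mul_inv_of_mul_eq (of_mul_t_pow φ hφ g k)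
  rw [hg]
  exact (Commute.conj_iff _).2 (h.map HNNExtension.of)

end DescHNN

/-- Let `G = A × B`, and let `φ` be an injective endomorphism of `G` with `Aφ ⊆ A` and
`Bφ ⊆ B`. Let `b ∈ B` and let `D` be the subgroup of `G(φ)` generated by `A` and the
element `tb`. Then `D` contains the subgroup `U = ⋃_{k ≥ 0} tᵏAt⁻ᵏ`. -/
theorem subgroup_U_le_D {A B : Type*} [Group A] [Group B]
    (φ : A × B →* A × B) (hφ : Function.Injective φ)
    (hAφ : ((MonoidHom.inl A B).range).map φ ≤ (MonoidHom.inl A B).range)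
    (hBφ : ((MonoidHom.inr A B).range).map φ ≤ (MonoidHom.inr A B).range)
    (b : B) :
    (⨆ k : ℕ,
      (((MonoidHom.inl A B).range).map (HNNExtension.of : A × B →* DescHNN φ hφ)).map
        (MulAut.conj (HNNExtension.t ^ k)).toMonoidHom) ≤
    ((MonoidHom.inl A B).range).map (HNNExtension.of : A × B →* DescHNN φ hφ)
      ⊔ Subgroup.zpowers (HNNExtension.t * HNNExtension.of ((1, b) : A × B)) := by
  have hb (k : ℕ) : φ^[k] (1, b) ∈ (MonoidHom.inr A B).range := by
    induction k with
    | zero => exact ⟨b, rfl⟩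
    | succ k ih =>
      rw [Function.iterate_succ_apply']
      exact hBφ (Subgroup.mem_map_of_mem φ ih)
  refine iSup_le fun k => ?_
  rintro _ ⟨_, ⟨_, ⟨a, rfl⟩, rfl⟩, rfl⟩
  simp only [MulEquiv.coe_toMonoidHom, MulAut.conj_apply]
  induction k with
  | zero =>
    rw [pow_zero, one_mul, inv_one, mul_one]
    exact Subgroup.mem_sup_left (Subgroup.mem_map_of_mem _ (MonoidHom.mem_range.2 ⟨a, rfl⟩))
  | succ k ih =>
    have hcomm : Commute (φ^[k] (1, b)) (MonoidHom.inl A B a) := by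
      obtain ⟨c, hc⟩ := hb k
      rw [← hc]
      exact (MonoidHom.commute_inl_inr a c).symm
    have htb := Subgroup.mem_sup_right
      (S := ((MonoidHom.inl A B).range).map (HNNExtension.of : A × B →* DescHNN φ hφ))
      (Subgroup.mem_zpowers (HNNExtension.t * HNNExtension.of ((1, b) : A × B) : DescHNN φ hφ))
    convert mul_mem (mul_mem htb ih) (inv_mem htb) using 1
    rw [mul_assoc HNNExtension.t, (DescHNN.commute_of_conj_t_pow φ hφ hcomm).eq, pow_succ']
    group
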